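/- Let d ≥ 1 be an integer and let 0 < k < d. There exists a constant C > 0, depending only on d and k, such that the following holds for every integer m ≥ 1. Let t₁, …, t_m > 0 be pairwise distinct and let σ be the permutation of {1, …, m} with t_{σ(1)} < t_{σ(2)} < … < t_{σ(m)}; set t_{σ(0)} := 0 and y₀ := 0 and y_{σ(0)} := 0. Then ∫_{(ℝ^d)^m} (∏_{i=1}^m p_{t_{σ(i)} − t_{σ(i−1)}}(y_{σ(i)} − y_{σ(i−1)})) · (∏_{i=1}^m |y_i − y_{i−1}|^{−k}) dy₁ … dy_m ≤ C^m · ∏_{i=1}^m (t_{σ(i)} − t_{σ(i−1)})^{−k/2}. (Probabilistically, the left-hand side is E[∏_{i=1}^m |W(t_i) − W(t_{i−1})|^{−k}] for a d-dimensional Brownian motion W started at 0, since the first product is the joint density of (W(t₁), …, W(t_m)).) -/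

import Mathlib

open Real MeasureTheory

/-- The Gaussian heat kernel `p_t(x) = (2πt)^{-d/2} exp(-|x|²/(2t))` on `ℝ^d`. -/
noncomputable def heatKernel (d : ℕ) (t : ℝ) (x : EuclideanSpace ℝ (Fin d)) : ℝ :=
  (2 * Real.pi * t) ^ (-(d : ℝ) / 2) * Real.exp (-‖x‖ ^ 2 / (2 * t))

/-- The value preceding `z i` in a finite sequence, with the convention `z₀ = 0`. -/
def fprev {m : ℕ} {E : Type*} [Zero E] (z : Fin m → E) (i : Fin m) : E :=
  if (i : ℕ) = 0 then 0
  else z ⟨(i : ℕ) - 1, lt_of_le_of_lt (Nat.sub_le _ _) i.isLt⟩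

open scoped ENNReal

section HeatKernel

variable {d : ℕ}

theorem heatKernel_nonneg {t : ℝ} (ht : 0 < t) (x : EuclideanSpace ℝ (Fin d)) :
    0 ≤ heatKernel d t x := by
  unfold heatKernel; positivity

theorem heatKernel_le {t : ℝ} (ht : 0 < t) (x : EuclideanSpace ℝ (Fin d)) :
    heatKernel d t x ≤ (2 * π * t) ^ (-(d : ℝ) / 2) := by
  unfold heatKernel
  refine mul_le_of_le_one_right (by positivity) (Real.exp_le_one_iff.2 ?_)
  rw [neg_div]
  exact neg_nonpos.2 (by positivity)

@[fun_prop]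
theorem measurable_heatKernel (t : ℝ) : Measurable (heatKernel d t) := by
  unfold heatKernel; fun_prop

theorem lintegral_heatKernel {t : ℝ} (ht : 0 < t) :
    ∫⁻ x, ENNReal.ofReal (heatKernel d t x) = 1 := by
  have h2 : (0 : ℝ) < 1 / (2 * t) := by positivity
  have hpt : 0 < 2 * π * t := by positivity
  have hI : ∫ x, heatKernel d t x = 1 := by
    have h := GaussianFourier.integral_rexp_neg_mul_sq_norm
      (V := EuclideanSpace ℝ (Fin d)) h2
    simp only [heatKernel]
    rw [integral_const_mul]
    have e : ∀ x : EuclideanSpace ℝ (Fin d),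
        -‖x‖ ^ 2 / (2 * t) = -(1 / (2 * t)) * ‖x‖ ^ 2 := fun x => by ring
    simp only [e]
    rw [h, finrank_euclideanSpace_fin, show π / (1 / (2 * t)) = 2 * π * t by field_simp,
      ← Real.rpow_add hpt, neg_div, neg_add_cancel, Real.rpow_zero]
  have hint : Integrable (heatKernel d t) := by
    by_contra h
    rw [integral_undef h] at hI
    exact zero_ne_one hI
  rw [← ofReal_integral_eq_lintegral_ofReal hint
    (Filter.Eventually.of_forall (heatKernel_nonneg ht)), hI, ENNReal.ofReal_one]

theorem lintegral_ball_enorm_rpow (hd : 1 ≤ d) {k : ℝ} (hkd : k < d) {r : ℝ} (hr : 0 < r) :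
    ∫⁻ x : EuclideanSpace ℝ (Fin d) in Metric.ball 0 r, ‖x‖ₑ ^ (-k) =
      ENNReal.ofReal (r ^ ((d : ℝ) - k) *
        ∫ x : EuclideanSpace ℝ (Fin d) in Metric.ball 0 1, ‖x‖ ^ (-k)) := by
  have : Nonempty (Fin d) := ⟨⟨0, hd⟩⟩
  have hint : IntegrableOn (fun x : EuclideanSpace ℝ (Fin d) => ‖x‖ ^ (-k)) (Metric.ball 0 r) := by
    refine integrableOn_ball_of_norm_le_rpow (C := 1) (α := k) (by simpa using hd)
      (by simpa using hkd) ?_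
      (measurable_norm.pow_const _).aestronglyMeasurable
    refine Filter.Eventually.of_forall fun x => ?_
    rw [one_mul, Real.norm_of_nonneg (by positivity)]
  have hscale : ∫ x : EuclideanSpace ℝ (Fin d) in Metric.ball 0 r, ‖x‖ ^ (-k) =
      r ^ ((d : ℝ) - k) * ∫ x : EuclideanSpace ℝ (Fin d) in Metric.ball 0 1, ‖x‖ ^ (-k) := by
    have h := Measure.setIntegral_comp_smul_of_pos (volume : Measure (EuclideanSpace ℝ (Fin d)))
      (fun x => ‖x‖ ^ (-k)) (Metric.ball 0 1) hr
    have e : ∀ x : EuclideanSpace ℝ (Fin d), ‖r • x‖ ^ (-k) = r ^ (-k) * ‖x‖ ^ (-k) := fun x => by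
      rw [norm_smul, Real.norm_of_nonneg hr.le, Real.mul_rpow hr.le (norm_nonneg _)]
    simp only [e] at h
    rw [integral_const_mul, smul_unitBall_of_pos hr, finrank_euclideanSpace_fin, smul_eq_mul] at h
    rw [sub_eq_add_neg, Real.rpow_add hr, mul_assoc, h, Real.rpow_natCast,
      mul_inv_cancel_left₀ (by positivity)]
  rw [← hscale, ofReal_integral_eq_lintegral_ofReal hint
    (Filter.Eventually.of_forall fun x => by positivity)]
  refine lintegral_congr_ae (ae_restrict_of_ae ?_)
  have h0 : ∀ᵐ x : EuclideanSpace ℝ (Fin d), x ≠ 0 := by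
    simp [ae_iff]
  filter_upwards [h0] with x hx
  rw [← ENNReal.ofReal_rpow_of_pos (norm_pos_iff.2 hx), ofReal_norm]

theorem exists_lintegral_heatKernel_mul_enorm_rpow_le (hd : 1 ≤ d) {k : ℝ} (hk : 0 < k)
    (hkd : k < d) : ∃ D : ℝ, 0 < D ∧ ∀ s : ℝ, 0 < s → ∀ w a : EuclideanSpace ℝ (Fin d),
      ∫⁻ x, ENNReal.ofReal (heatKernel d s (x - w)) * ‖x - a‖ₑ ^ (-k) ≤
        ENNReal.ofReal (D * s ^ (-k / 2)) := by
  set J := ∫ x : EuclideanSpace ℝ (Fin d) in Metric.ball 0 1, ‖x‖ ^ (-k) with hJ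
  have hJ0 : 0 ≤ J := integral_nonneg fun x => by positivity
  refine ⟨(2 * π) ^ (-(d : ℝ) / 2) * J + 1, by positivity, fun s hs w a => ?_⟩
  have hpt : ∀ x : EuclideanSpace ℝ (Fin d),
      ENNReal.ofReal (heatKernel d s (x - w)) * ‖x - a‖ₑ ^ (-k) ≤
        ENNReal.ofReal ((2 * π * s) ^ (-(d : ℝ) / 2)) *
          (Metric.ball 0 √s).indicator (fun u => ‖u‖ₑ ^ (-k)) (x - a) +
        ENNReal.ofReal (heatKernel d s (x - w)) * ENNReal.ofReal (s ^ (-k / 2)) := fun x => by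
    by_cases hx : x - a ∈ Metric.ball 0 √s
    · rw [Set.indicator_of_mem hx]
      refine le_add_right ?_
      gcongr
      exact heatKernel_le hs _
    · refine le_add_left ?_
      gcongr
      have hx' : √s ≤ ‖x - a‖ := by simpa using hx
      have hs' : 0 < √s := Real.sqrt_pos.2 hs
      rw [← ofReal_norm, ENNReal.ofReal_rpow_of_pos (hs'.trans_le hx')]
      refine ENNReal.ofReal_le_ofReal ?_
      refine (Real.rpow_le_rpow_of_nonpos hs' hx' (by linarith)).trans_eq ?_
      rw [Real.sqrt_eq_rpow, ← Real.rpow_mul hs.le]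
      congr 1; ring
  refine (lintegral_mono hpt).trans ?_
  have hm1 : Measurable fun x : EuclideanSpace ℝ (Fin d) =>
      (Metric.ball 0 √s).indicator (fun u => ‖u‖ₑ ^ (-k)) x :=
    Measurable.indicator (by fun_prop) measurableSet_ball
  rw [lintegral_add_right _ (by fun_prop), lintegral_const_mul _ (by fun_prop),
    lintegral_mul_const _ (by fun_prop),
    lintegral_sub_right_eq_self (fun x => (Metric.ball 0 √s).indicator (fun u => ‖u‖ₑ ^ (-k)) x) a,
    lintegral_sub_right_eq_self (fun x => ENNReal.ofReal (heatKernel d s x)) w,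
    lintegral_heatKernel hs, one_mul, lintegral_indicator measurableSet_ball,
    lintegral_ball_enorm_rpow hd hkd (Real.sqrt_pos.2 hs), ← hJ,
    ← ENNReal.ofReal_mul (by positivity), ← ENNReal.ofReal_add (by positivity) (by positivity)]
  refine ENNReal.ofReal_le_ofReal (le_of_eq ?_)
  rw [Real.mul_rpow (by positivity) hs.le, Real.sqrt_eq_rpow, ← Real.rpow_mul hs.le,
    show -k / 2 = -(d : ℝ) / 2 + 1 / 2 * (d - k) by ring, Real.rpow_add hs]
  ring

end HeatKernel

section Chain

variable {E : Type*} [NormedAddCommGroup E]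

theorem enorm_rpow_mul_enorm_rpow_le {k : ℝ} (hk : 0 < k) (u v : E) :
    ‖u‖ₑ ^ (-k) * ‖v‖ₑ ^ (-k) ≤ 2 ^ k * ‖u + v‖ₑ ^ (-k) * (‖u‖ₑ ^ (-k) + ‖v‖ₑ ^ (-k)) := by
  wlog h : ‖u‖ₑ ≤ ‖v‖ₑ generalizing u v
  · rw [mul_comm, add_comm u, add_comm (‖u‖ₑ ^ (-k))]
    exact this v u (le_of_not_ge h)
  have hv : ‖v‖ₑ ^ (-k) ≤ 2 ^ k * ‖u + v‖ₑ ^ (-k) := by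
    have h2 : ‖u + v‖ₑ ≤ 2 * ‖v‖ₑ := (enorm_add_le u v).trans (by rw [two_mul]; gcongr)
    calc ‖v‖ₑ ^ (-k) = 2 ^ k * (2 * ‖v‖ₑ) ^ (-k) := by
          rw [ENNReal.mul_rpow_of_ne_top (by simp) (by simp), ← mul_assoc,
            ← ENNReal.rpow_add _ _ (by simp) (by simp), add_neg_cancel, ENNReal.rpow_zero, one_mul]
      _ ≤ 2 ^ k * ‖u + v‖ₑ ^ (-k) := by
          refine mul_le_mul_right ?_ _
          rw [ENNReal.rpow_neg, ENNReal.rpow_neg]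
          gcongr
  rw [mul_comm]
  gcongr
  exact le_self_add

/-- The product of `‖z - z'‖ ^ (-k)` over consecutive pairs of the sequence `a :: l`. -/
noncomputable def rieszChain (k : ℝ) : E → List E → ℝ≥0∞
  | _, [] => 1
  | a, b :: l => ‖b - a‖ₑ ^ (-k) * rieszChain k b l

theorem measurable_rieszChain [MeasurableSpace E] [BorelSpace E] [SecondCountableTopology E]
    {α ι : Type*} [MeasurableSpace α] (k : ℝ) (l : List ι) {a : α → E} (ha : Measurable a)
    {f : α → ι → E} (hf : ∀ i, Measurable fun x => f x i) :
    Measurable fun x => rieszChain k (a x) (l.map (f x)) := by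
  induction l generalizing a with
  | nil => exact measurable_const
  | cons i l ih =>
    simp only [List.map_cons, rieszChain]
    exact (((hf i).sub ha).enorm.pow_const _).mul (ih (hf i))

theorem rieszChain_ofFn (k : ℝ) {m : ℕ} (a : E) (y : Fin m → E) :
    rieszChain k a (List.ofFn y) =
      ∏ i : Fin m, ‖y i - Fin.cons (α := fun _ => E) a y i.castSucc‖ₑ ^ (-k) := by
  induction m generalizing a with
  | zero => simp [rieszChain]
  | succ m ih =>
    rw [List.ofFn_succ, rieszChain, ih, Fin.prod_univ_succ]
    congr 1
    refine Finset.prod_congr rfl fun i _ => ?_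
    rw [Fin.castSucc_succ, Fin.cons_succ]
    congr 3
    exact congrFun (Fin.cons_self_tail y) _

theorem fprev_eq_cons {m : ℕ} {F : Type*} [Zero F] (z : Fin m → F) (i : Fin m) :
    fprev z i = Fin.cons (α := fun _ => F) 0 z i.castSucc := by
  cases m with
  | zero => exact i.elim0
  | succ m =>
    induction i using Fin.cases with
    | zero => simp [fprev]
    | succ i =>
      rw [Fin.castSucc_succ, Fin.cons_succ]
      simp [fprev]
      rfl

variable [MeasurableSpace E] [BorelSpace E] [SecondCountableTopology E]

theorem lintegral_mul_rieszChain_insert_le {k : ℝ} (hk : 0 < k) (μ : Measure E) {p : E → ℝ≥0∞}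
    (hp : Measurable p) {B : ℝ≥0∞} (hB : ∀ a, ∫⁻ x, p x * ‖x - a‖ₑ ^ (-k) ∂μ ≤ B)
    (a : E) (l₁ l₂ : List E) :
    ∫⁻ x, p x * rieszChain k a (l₁ ++ x :: l₂) ∂μ ≤
      2 ^ k * 2 * B * rieszChain k a (l₁ ++ l₂) := by
  induction l₁ generalizing a with
  | nil =>
    cases l₂ with
    | nil =>
      simp only [List.nil_append, rieszChain, mul_one]
      refine (hB a).trans (le_mul_of_one_le_left' ?_)
      calc (1 : ℝ≥0∞) ≤ 1 * 2 := by norm_num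
        _ ≤ 2 ^ k * 2 := by gcongr; exact ENNReal.one_le_rpow (by norm_num) hk
    | cons c l =>
      simp only [List.nil_append, rieszChain]
      have hm : ∀ b : E, Measurable fun x => p x * ‖x - b‖ₑ ^ (-k) := fun b => by fun_prop
      calc ∫⁻ x, p x * (‖x - a‖ₑ ^ (-k) * (‖c - x‖ₑ ^ (-k) * rieszChain k c l)) ∂μ
          ≤ ∫⁻ x, 2 ^ k * (‖c - a‖ₑ ^ (-k) * rieszChain k c l) *
              (p x * ‖x - a‖ₑ ^ (-k) + p x * ‖x - c‖ₑ ^ (-k)) ∂μ := by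
            refine lintegral_mono fun x => ?_
            have h := enorm_rpow_mul_enorm_rpow_le hk (x - a) (c - x)
            rw [add_comm (x - a), sub_add_sub_cancel] at h
            calc _ = p x * rieszChain k c l * (‖x - a‖ₑ ^ (-k) * ‖c - x‖ₑ ^ (-k)) := by ring
              _ ≤ p x * rieszChain k c l * (2 ^ k * ‖c - a‖ₑ ^ (-k) *
                    (‖x - a‖ₑ ^ (-k) + ‖c - x‖ₑ ^ (-k))) := by gcongr
              _ = _ := by rw [← enorm_neg (c - x), neg_sub]; ring
        _ = 2 ^ k * (‖c - a‖ₑ ^ (-k) * rieszChain k c l) *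
              (∫⁻ x, p x * ‖x - a‖ₑ ^ (-k) ∂μ + ∫⁻ x, p x * ‖x - c‖ₑ ^ (-k) ∂μ) := by
            rw [lintegral_const_mul _ (by fun_prop), lintegral_add_left (hm a)]
        _ ≤ 2 ^ k * (‖c - a‖ₑ ^ (-k) * rieszChain k c l) * (B + B) := by
            gcongr
            exacts [hB a, hB c]
        _ = _ := by ring
  | cons b l ih =>
    simp only [List.cons_append, rieszChain]
    have hm : Measurable fun x : E => rieszChain k b (l ++ x :: l₂) := by
      have := measurable_rieszChain (E := E) k
        (l.map some ++ none :: l₂.map some) (a := fun _ : E => b) measurable_const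
        (f := fun x o => Option.elim o x id)
        (by rintro (_ | e); exacts [measurable_id, measurable_const])
      simpa [Function.comp_def] using this
    calc ∫⁻ x, p x * (‖b - a‖ₑ ^ (-k) * rieszChain k b (l ++ x :: l₂)) ∂μ
        = ‖b - a‖ₑ ^ (-k) * ∫⁻ x, p x * rieszChain k b (l ++ x :: l₂) ∂μ := by
          rw [← lintegral_const_mul _ (by fun_prop)]
          exact lintegral_congr fun x => by ring
      _ ≤ ‖b - a‖ₑ ^ (-k) * (2 ^ k * 2 * B * rieszChain k b (l ++ l₂)) := by gcongr; exact ih b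
      _ = _ := by ring

end Chain

theorem fprev_castSucc {m : ℕ} {F : Type*} [Zero F] (z : Fin (m + 1) → F) (i : Fin m) :
    fprev z i.castSucc = fprev (fun j : Fin m => z j.castSucc) i := rfl

theorem fprev_snoc_last {m : ℕ} {F : Type*} [Zero F] (z : Fin m → F) (x : F) :
    fprev (Fin.snoc (α := fun _ => F) z x) (Fin.last m) =
      fprev (Fin.snoc (α := fun _ => F) z 0) (Fin.last m) := by
  rw [fprev_eq_cons, fprev_eq_cons]
  cases m with
  | zero => rfl
  | succ m =>
    rw [← Fin.succ_last, Fin.castSucc_succ, Fin.cons_succ, Fin.cons_succ, Fin.snoc_castSucc,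
      Fin.snoc_castSucc]

theorem measurable_fprev {m : ℕ} {F : Type*} [Zero F] [MeasurableSpace F] (i : Fin m) :
    Measurable fun z : Fin m → F => fprev z i := by
  unfold fprev
  split_ifs
  exacts [measurable_const, measurable_pi_apply _]

theorem exists_eq_append_last_cons {m : ℕ} {l : List (Fin (m + 1))}
    (hl : l.Perm (List.finRange (m + 1))) :
    ∃ l₁ l₂ : List (Fin m), l = l₁.map Fin.castSucc ++ Fin.last m :: l₂.map Fin.castSucc ∧
      (l₁ ++ l₂).Perm (List.finRange m) := by
  obtain ⟨l₁, l₂, rfl⟩ := List.append_of_mem (hl.mem_iff.2 (List.mem_finRange (Fin.last m)))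
  have hl' : (Fin.last m :: (l₁ ++ l₂)).Perm
      (Fin.last m :: (List.finRange m).map Fin.castSucc) := by
    refine List.perm_middle.symm.trans (hl.trans ?_)
    rw [List.finRange_succ_last]
    exact List.perm_append_singleton _ _
  have hp := hl'.cons_inv
  have hr : ∀ i ∈ l₁ ++ l₂, i ∈ Set.range (Fin.castSucc (n := m)) := fun i hi => by
    obtain ⟨j, -, hj⟩ := List.mem_map.1 (hp.mem_iff.1 hi)
    exact ⟨j, hj⟩
  obtain ⟨l', hl'⟩ : l₁ ++ l₂ ∈ Set.range (List.map (Fin.castSucc (n := m))) := by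
    rw [Set.range_list_map]; exact hr
  obtain ⟨a, b, rfl, rfl, rfl⟩ := List.map_eq_append_iff.1 hl'
  rw [← List.map_append] at hp
  exact ⟨a, b, rfl, (List.map_perm_map_iff (Fin.castSucc_injective m)).1 hp⟩

theorem lintegral_prod_heatKernel_mul_rieszChain_le {d : ℕ} {k : ℝ} (hk : 0 < k) {D : ℝ}
    (hD : ∀ s : ℝ, 0 < s → ∀ w a : EuclideanSpace ℝ (Fin d),
      ∫⁻ x, ENNReal.ofReal (heatKernel d s (x - w)) * ‖x - a‖ₑ ^ (-k) ≤
        ENNReal.ofReal (D * s ^ (-k / 2)))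
    {m : ℕ} (s : Fin m → ℝ) (hs : ∀ i, 0 < s i) {l : List (Fin m)}
    (hl : l.Perm (List.finRange m)) :
    ∫⁻ z : Fin m → EuclideanSpace ℝ (Fin d),
        (∏ i, ENNReal.ofReal (heatKernel d (s i) (z i - fprev z i))) *
          rieszChain k 0 (l.map z) ≤
      ∏ i, 2 ^ k * 2 * ENNReal.ofReal (D * s i ^ (-k / 2)) := by
  induction m with
  | zero =>
    obtain rfl : l = [] := by simpa using hl
    simp [rieszChain, lintegral_unique, volume_pi]
  | succ m ih =>
    obtain ⟨l₁, l₂, rfl, hp⟩ := exists_eq_append_last_cons hl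
    have hmeas : ∀ {n : ℕ} (u : Fin n → ℝ) (l : List (Fin n)),
        Measurable fun z : Fin n → EuclideanSpace ℝ (Fin d) =>
          (∏ i, ENNReal.ofReal (heatKernel d (u i) (z i - fprev z i))) *
            rieszChain k 0 (l.map z) := fun u l =>
      (Finset.measurable_fun_prod _ fun i _ => (measurable_heatKernel (u i)).ennreal_ofReal.comp
        ((measurable_pi_apply i).sub (measurable_fprev i))).mul
        (measurable_rieszChain k l measurable_const measurable_pi_apply)
    have e := (volume_preserving_piFinSuccAbove
      (fun _ : Fin (m + 1) => EuclideanSpace ℝ (Fin d)) (Fin.last m)).symm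
    rw [← e.lintegral_comp (hmeas s _), Measure.volume_eq_prod,
      lintegral_prod_symm' _ (by exact (hmeas s _).comp e.measurable), Fin.prod_univ_castSucc]
    have hsnoc : ∀ (x : EuclideanSpace ℝ (Fin d)) (z : Fin m → EuclideanSpace ℝ (Fin d)),
        (MeasurableEquiv.piFinSuccAbove (fun _ => EuclideanSpace ℝ (Fin d)) (Fin.last m)).symm
          (x, z) = Fin.snoc (α := fun _ => EuclideanSpace ℝ (Fin d)) z x := fun x z =>
      Fin.insertNth_last' x z
    simp only [hsnoc, Fin.prod_univ_castSucc, fprev_castSucc, Fin.snoc_castSucc, Fin.snoc_last,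
      List.map_append, List.map_cons, List.map_map, Function.comp_def]
    set B := ENNReal.ofReal (D * s (Fin.last m) ^ (-k / 2))
    calc ∫⁻ z : Fin m → EuclideanSpace ℝ (Fin d), ∫⁻ x : EuclideanSpace ℝ (Fin d), _
        ≤ ∫⁻ z : Fin m → EuclideanSpace ℝ (Fin d),
            (∏ i : Fin m, ENNReal.ofReal (heatKernel d (s i.castSucc) (z i - fprev z i))) *
              (2 ^ k * 2 * B * rieszChain k 0 (l₁.map z ++ l₂.map z)) := by
          refine lintegral_mono fun z => ?_
          simp only [mul_assoc]
          rw [lintegral_const_mul']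
          · simp only [fprev_snoc_last z]
            gcongr
            refine (lintegral_mul_rieszChain_insert_le hk volume
              (by fun_prop)
              (fun a => hD _ (hs (Fin.last m)) _ a) 0 (l₁.map z) (l₂.map z)).trans_eq ?_
            simp only [mul_assoc, B]
          · exact ENNReal.prod_ne_top fun i _ => ENNReal.ofReal_ne_top
      _ = (∫⁻ z : Fin m → EuclideanSpace ℝ (Fin d),
            (∏ i : Fin m, ENNReal.ofReal (heatKernel d (s i.castSucc) (z i - fprev z i))) *
              rieszChain k 0 ((l₁ ++ l₂).map z)) * (2 ^ k * 2 * B) := by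
          rw [← lintegral_mul_const _ (hmeas _ _)]
          refine lintegral_congr fun z => ?_
          rw [List.map_append]
          ring
      _ ≤ _ := by
          gcongr
          exact ih _ (fun i => hs _) hp

theorem fprev_lt_of_strictMono {m : ℕ} {t : Fin m → ℝ} (ht : ∀ i, 0 < t i) (hm : StrictMono t)
    (i : Fin m) : fprev t i < t i := by
  unfold fprev
  split_ifs with h
  · exact ht i
  · exact hm (Fin.lt_def.2 (Nat.sub_lt (Nat.pos_of_ne_zero h) one_pos))

theorem increment_riesz_bound (d : ℕ) (hd : 1 ≤ d) (k : ℝ)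
    (hk0 : 0 < k) (hkd : k < d) :
    ∃ C : ℝ, 0 < C ∧ ∀ m : ℕ, 1 ≤ m → ∀ t : Fin m → ℝ, (∀ i, 0 < t i) →
      Function.Injective t →
      ∀ σ : Equiv.Perm (Fin m), StrictMono (fun i => t (σ i)) →
        (∫ y : Fin m → EuclideanSpace ℝ (Fin d),
            (∏ i : Fin m, heatKernel d (t (σ i) - fprev (fun j => t (σ j)) i)
                ((fun j => y (σ j)) i - fprev (fun j => y (σ j)) i)) *
              ∏ i : Fin m, ‖y i - fprev y i‖ ^ (-k)) ≤
          C ^ m * ∏ i : Fin m, (t (σ i) - fprev (fun j => t (σ j)) i) ^ (-k / 2) := by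
  obtain ⟨D, hD0, hD⟩ := exists_lintegral_heatKernel_mul_enorm_rpow_le hd hk0 hkd
  refine ⟨2 ^ k * 2 * D, by positivity, fun m _ t ht _ σ hσ => ?_⟩
  set s : Fin m → ℝ := fun i => t (σ i) - fprev (fun j => t (σ j)) i
  have hs : ∀ i, 0 < s i := fun i =>
    sub_pos.2 (fprev_lt_of_strictMono (fun i => ht (σ i)) hσ i)
  have hs' : ∀ i, 0 ≤ s i ^ (-k / 2) := fun i => Real.rpow_nonneg (hs i).le _
  have hR : 0 ≤ (2 ^ k * 2 * D) ^ m * ∏ i : Fin m, s i ^ (-k / 2) :=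
    mul_nonneg (by positivity) (Finset.prod_nonneg fun i _ => hs' i)
  rw [← ENNReal.ofReal_le_ofReal_iff hR]
  set l : List (Fin m) := List.ofFn σ.symm
  have hl : l.Perm (List.finRange m) := by
    rw [List.perm_ext_iff_of_nodup (List.nodup_ofFn.2 σ.symm.injective) (List.nodup_finRange m)]
    intro i
    simpa [l, List.mem_ofFn] using σ.symm.surjective i
  have e := volume_measurePreserving_piCongrLeft (fun _ : Fin m => EuclideanSpace ℝ (Fin d)) σ.symm
  have he : ∀ (y : Fin m → EuclideanSpace ℝ (Fin d)),
      MeasurableEquiv.piCongrLeft (fun _ => EuclideanSpace ℝ (Fin d)) σ.symm y =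
        fun j => y (σ j) := fun y => by
    ext1 j
    obtain ⟨i, rfl⟩ := σ.symm.surjective j
    rw [MeasurableEquiv.coe_piCongrLeft, Equiv.piCongrLeft_apply_apply, Equiv.apply_symm_apply]
  have hnorm : ∀ x : EuclideanSpace ℝ (Fin d), ENNReal.ofReal (‖x‖ ^ (-k)) ≤ ‖x‖ₑ ^ (-k) :=
    fun x => by
    rcases eq_or_ne x 0 with rfl | hx
    · simp [hk0]
    · rw [← ofReal_norm, ENNReal.ofReal_rpow_of_pos (norm_pos_iff.2 hx)]
  calc _ ≤ ‖_‖ₑ := Real.ofReal_le_enorm _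
    _ ≤ _ := enorm_integral_le_lintegral_enorm _
    _ ≤ ∫⁻ y : Fin m → EuclideanSpace ℝ (Fin d), (fun z : Fin m → EuclideanSpace ℝ (Fin d) =>
          (∏ i, ENNReal.ofReal (heatKernel d (s i) (z i - fprev z i))) *
            rieszChain k 0 (l.map z))
          (MeasurableEquiv.piCongrLeft (fun _ => EuclideanSpace ℝ (Fin d)) σ.symm y) := by
        refine lintegral_mono fun y => ?_
        simp only [he]
        have hly : l.map (fun j => y (σ j)) = List.ofFn y := by
          simp [l, List.map_ofFn, Function.comp_def]
        have hpos : ∀ i ∈ Finset.univ,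
            0 ≤ heatKernel d (s i) (y (σ i) - fprev (fun j => y (σ j)) i) :=
          fun i _ => heatKernel_nonneg (hs i) _
        rw [hly, rieszChain_ofFn, Real.enorm_of_nonneg (mul_nonneg (Finset.prod_nonneg hpos)
          (Finset.prod_nonneg fun i _ => by positivity)),
          ENNReal.ofReal_mul (Finset.prod_nonneg hpos), ENNReal.ofReal_prod_of_nonneg hpos,
          ENNReal.ofReal_prod_of_nonneg (fun i _ => by positivity)]
        gcongr with i
        rw [← fprev_eq_cons]
        exact hnorm _
    _ = _ := e.lintegral_comp_emb (MeasurableEquiv.measurableEmbedding _)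
        (fun z : Fin m → EuclideanSpace ℝ (Fin d) =>
          (∏ i, ENNReal.ofReal (heatKernel d (s i) (z i - fprev z i))) *
            rieszChain k 0 (l.map z))
    _ ≤ _ := lintegral_prod_heatKernel_mul_rieszChain_le hk0 hD s hs hl
    _ = _ := by
        have h2 : (2 : ℝ≥0∞) ^ k * 2 = ENNReal.ofReal (2 ^ k * 2) := by
          rw [ENNReal.ofReal_mul (by positivity), ← ENNReal.ofReal_rpow_of_pos two_pos]
          simp
        rw [h2]
        simp only [← ENNReal.ofReal_mul (show (0 : ℝ) ≤ 2 ^ k * 2 by positivity)]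
        rw [← ENNReal.ofReal_prod_of_nonneg
          (fun i _ => mul_nonneg (by positivity) (mul_nonneg hD0.le (hs' i)))]
        simp only [← mul_assoc, Finset.prod_mul_distrib, Finset.prod_const, Finset.card_univ,
          Fintype.card_fin, mul_pow]
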